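/- arXiv:2203.10831 — 2 statements merged into one kernel-verified Lean document; each statement's English description precedes it below -/
import Mathlib

section
/- Assume Setup (†). Let G_in = ∪_{i=1}^{r} G[V_i] be the union of the induced subgraphs on the parts, let K be the complete r-partite graph on the parts V₁, …, V_r, and let G_out be the graph on V(G) whose edge set is E(K) \ E(G). Then for all sufficiently large n, e(G_in) − e(G_out) ≤ a. -/
open SimpleGraph

/-- The adjacency matrix of a simple graph over `ℝ`. -/
noncomputable def adjMat {V : Type*} [Fintype V] (G : SimpleGraph V) : Matrix V V ℝ :=
  letI := Classical.decRel G.Adj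
  G.adjMatrix ℝ

/-- The spectral radius of a simple graph: the largest eigenvalue of its adjacency matrix. -/
noncomputable def specRad {V : Type*} [Fintype V] [DecidableEq V] (G : SimpleGraph V) : ℝ :=
  sSup (spectrum ℝ (adjMat G))

/-- The number of edges of a simple graph. -/
noncomputable def eCnt {V : Type*} (G : SimpleGraph V) : ℕ := Nat.card G.edgeSet

/-- `G` contains a copy of `F` (a subgraph isomorphic to `F`). -/
def Contains {W V : Type*} (F : SimpleGraph W) (G : SimpleGraph V) : Prop :=
  ∃ f : F →g G, Function.Injective f

/-- `G` is `F`-free. -/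
def FFree {W V : Type*} (F : SimpleGraph W) (G : SimpleGraph V) : Prop := ¬ Contains F G

/-- The Turán number `ex(n, F)`. -/
noncomputable def exNum {W : Type*} (n : ℕ) (F : SimpleGraph W) : ℕ :=
  sSup {m | ∃ G : SimpleGraph (Fin n), FFree F G ∧ eCnt G = m}

/-- `G` is obtained from the Turán graph `T_{n,r}` by adding `a` edges. -/
def TuranPlus (n r a : ℕ) (G : SimpleGraph (Fin n)) : Prop :=
  (∃ H : SimpleGraph (Fin n), H ≤ G ∧ Nonempty (H ≃g turanGraph n r)) ∧
    eCnt G = eCnt (turanGraph n r) + a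

/-- Hypothesis (★): for all sufficiently large `m`, `ex(m,F) = e(T_{m,r}) + a` and every
extremal graph is obtained from `T_{m,r}` by adding `a` edges. -/
def HypStar {W : Type*} (r a : ℕ) (F : SimpleGraph W) : Prop :=
  ∃ m₀ : ℕ, ∀ m ≥ m₀,
    exNum m F = eCnt (turanGraph m r) + a ∧
    ∀ G : SimpleGraph (Fin m), FFree F G → eCnt G = exNum m F → TuranPlus m r a G

/-- `G` is a spectral-extremal `F`-free graph on its vertex set. -/
def SpecExtremal {W : Type*} (F : SimpleGraph W) {n : ℕ} (G : SimpleGraph (Fin n)) : Prop :=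
  FFree F G ∧ ∀ G' : SimpleGraph (Fin n), FFree F G' → specRad G' ≤ specRad G

/-- Number of edges of `G` joining two distinct parts of the partition `p`. -/
noncomputable def crossCnt {n r : ℕ} (G : SimpleGraph (Fin n)) (p : Fin n → Fin r) : ℕ :=
  Nat.card {e : Sym2 (Fin n) // e ∈ G.edgeSet ∧ ¬ (Sym2.map p e).IsDiag}

/-- Number of edges of `G` inside part `i` of the partition `p`, i.e. `e(G[Vᵢ])`. -/
noncomputable def inCnt {n r : ℕ} (G : SimpleGraph (Fin n)) (p : Fin n → Fin r)
    (i : Fin r) : ℕ :=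
  Nat.card {e : Sym2 (Fin n) // e ∈ G.edgeSet ∧ Sym2.map p e = Sym2.diag i}

/-- The size of part `i` of the partition `p`, i.e. `|Vᵢ|`. -/
noncomputable def partSize {n r : ℕ} (p : Fin n → Fin r) (i : Fin r) : ℕ :=
  Nat.card {v : Fin n // p v = i}

/-- The degree of `v` in `G`. -/
noncomputable def deg {n : ℕ} (G : SimpleGraph (Fin n)) (v : Fin n) : ℕ :=
  Nat.card (G.neighborSet v)

/-- `d_{Vᵢ}(v)`, the number of neighbours of `v` in part `i` of the partition `p`. -/
noncomputable def degIn {n r : ℕ} (G : SimpleGraph (Fin n)) (p : Fin n → Fin r)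
    (i : Fin r) (v : Fin n) : ℕ :=
  Nat.card {w : Fin n // G.Adj v w ∧ p w = i}

/-- The partition `p` into `r` parts maximizes the number of edges between distinct parts,
`∑ eᵢ(Vᵢ) ≤ ε n²`, and each part has size strictly between `(1/r − 3√ε)n` and `(1/r + 3√ε)n`. -/
def GoodPartition (r : ℕ) {n : ℕ} (G : SimpleGraph (Fin n)) (ε : ℝ)
    (p : Fin n → Fin r) : Prop :=
  (∀ q : Fin n → Fin r, crossCnt G q ≤ crossCnt G p) ∧
  (∑ i : Fin r, (inCnt G p i : ℝ)) ≤ ε * n ^ 2 ∧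
  ∀ i : Fin r, (1 / (r : ℝ) - 3 * Real.sqrt ε) * n < partSize p i ∧
    (partSize p i : ℝ) < (1 / (r : ℝ) + 3 * Real.sqrt ε) * n

/-- The set `L` of low-degree vertices. -/
def Lset (r : ℕ) {n : ℕ} (G : SimpleGraph (Fin n)) (ε : ℝ) : Set (Fin n) :=
  {v | (deg G v : ℝ) ≤ (1 - 1 / (r : ℝ) - 3 * r * ε ^ ((1 : ℝ) / 3)) * n}

/-- The set `W` of vertices with many neighbours inside their own part. -/
def Wset {n r : ℕ} (G : SimpleGraph (Fin n)) (p : Fin n → Fin r) (θ : ℝ) : Set (Fin n) :=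
  {v | 2 * θ * n ≤ (degIn G p (p v) v : ℝ)}

section Helpers

open Finset

open scoped Classical in
/-- The real-valued adjacency indicator of a graph. -/
noncomputable def adjInd {V : Type*} (H : SimpleGraph V) (x y : V) : ℝ :=
  if H.Adj x y then 1 else 0

lemma adjInd_nonneg {V : Type*} (H : SimpleGraph V) (x y : V) : 0 ≤ adjInd H x y := by
  unfold adjInd; split_ifs <;> norm_num

lemma adjInd_of_adj {V : Type*} {H : SimpleGraph V} {x y : V} (hxy : H.Adj x y) :
    adjInd H x y = 1 := if_pos hxy

lemma adjInd_of_not_adj {V : Type*} {H : SimpleGraph V} {x y : V} (hxy : ¬ H.Adj x y) :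
    adjInd H x y = 0 := if_neg hxy

lemma adjInd_comm {V : Type*} (H : SimpleGraph V) (x y : V) : adjInd H x y = adjInd H y x := by
  by_cases h : H.Adj x y
  · rw [adjInd_of_adj h, adjInd_of_adj h.symm]
  · rw [adjInd_of_not_adj h, adjInd_of_not_adj fun h' => h h'.symm]

open scoped Classical in
lemma sum_adjInd_eq_card {V : Type*} (H : SimpleGraph V) (x : V) (s : Finset V) :
    ∑ y ∈ s, adjInd H x y = #{y ∈ s | H.Adj x y} := by
  simp [adjInd, Finset.sum_boole]

lemma sum_sum_adjInd {V : Type*} [Fintype V] (H : SimpleGraph V) :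
    ∑ x, ∑ y, adjInd H x y = 2 * (eCnt H : ℝ) := by
  classical
  have h := H.sum_degrees_eq_twice_card_edges
  have hE : eCnt H = #H.edgeFinset := by
    rw [eCnt, Nat.card_eq_fintype_card, ← SimpleGraph.edgeFinset_card]
  rw [hE]
  have h' : (∑ v, (H.degree v : ℝ)) = 2 * (#H.edgeFinset : ℝ) := by exact_mod_cast h
  rw [← h']
  refine Finset.sum_congr rfl fun x _ => ?_
  rw [sum_adjInd_eq_card, ← SimpleGraph.card_neighborFinset_eq_degree,
    SimpleGraph.neighborFinset_eq_filter]

variable {n r : ℕ}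

/-- The edges of `G` inside the parts of `p`. -/
def inGraph (G : SimpleGraph (Fin n)) (p : Fin n → Fin r) : SimpleGraph (Fin n) where
  Adj x y := G.Adj x y ∧ p x = p y
  symm := ⟨fun _ _ h => ⟨h.1.symm, h.2.symm⟩⟩
  loopless := ⟨fun _ h => G.irrefl h.1⟩

/-- The edges of the complete multipartite graph on the parts of `p` missing from `G`. -/
def outGraph (G : SimpleGraph (Fin n)) (p : Fin n → Fin r) : SimpleGraph (Fin n) where
  Adj x y := p x ≠ p y ∧ ¬ G.Adj x y
  symm := ⟨fun _ _ h => ⟨h.1.symm, fun h' => h.2 h'.symm⟩⟩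
  loopless := ⟨fun _ h => h.1 rfl⟩

/-- Twice the excess of inner edges over missing cross edges spanned by `U`. -/
noncomputable def excess (G : SimpleGraph (Fin n)) (p : Fin n → Fin r)
    (U : Finset (Fin n)) : ℝ :=
  ∑ x ∈ U, ∑ y ∈ U, (adjInd (inGraph G p) x y - adjInd (outGraph G p) x y)

lemma eCnt_outGraph (G : SimpleGraph (Fin n)) (p : Fin n → Fin r) :
    eCnt (outGraph G p) =
      Nat.card {e : Sym2 (Fin n) // ¬ (Sym2.map p e).IsDiag ∧ e ∉ G.edgeSet} := by
  have : (outGraph G p).edgeSet = {e | ¬ (Sym2.map p e).IsDiag ∧ e ∉ G.edgeSet} := by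
    ext e
    induction e using Sym2.ind with
    | _ x y => simp [outGraph]
  rw [eCnt, this]
  rfl

lemma two_mul_sum_inCnt (G : SimpleGraph (Fin n)) (p : Fin n → Fin r) :
    2 * ∑ i, (inCnt G p i : ℝ) = ∑ x, ∑ y, adjInd (inGraph G p) x y := by
  classical
  let H : Fin r → SimpleGraph (Fin n) := fun i =>
    { Adj := fun x y => G.Adj x y ∧ p x = i ∧ p y = i
      symm := ⟨fun _ _ h => ⟨h.1.symm, h.2.2, h.2.1⟩⟩
      loopless := ⟨fun _ h => G.irrefl h.1⟩ }
  have hH : ∀ i, eCnt (H i) = inCnt G p i := by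
    intro i
    have : (H i).edgeSet = {e | e ∈ G.edgeSet ∧ Sym2.map p e = Sym2.diag i} := by
      ext e
      induction e using Sym2.ind with
      | _ x y => simp [H, Sym2.diag]
    rw [eCnt, this]
    rfl
  rw [Finset.mul_sum]
  simp_rw [← hH, ← sum_sum_adjInd]
  rw [Finset.sum_comm]
  refine Finset.sum_congr rfl fun x _ => ?_
  rw [Finset.sum_comm]
  refine Finset.sum_congr rfl fun y _ => ?_
  by_cases hxy : (inGraph G p).Adj x y
  · rw [adjInd_of_adj hxy, Finset.sum_eq_single (p x)]
    · exact adjInd_of_adj ⟨hxy.1, rfl, hxy.2.symm⟩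
    · intro i _ hi
      exact adjInd_of_not_adj fun h => hi h.2.1.symm
    · simp
  · rw [adjInd_of_not_adj hxy]
    refine Finset.sum_eq_zero fun i _ => adjInd_of_not_adj fun h => hxy ⟨h.1, ?_⟩
    rw [h.2.1, h.2.2]

lemma excess_univ (G : SimpleGraph (Fin n)) (p : Fin n → Fin r) :
    excess G p univ = 2 * ∑ i, (inCnt G p i : ℝ) - 2 * (eCnt (outGraph G p) : ℝ) := by
  rw [two_mul_sum_inCnt, ← sum_sum_adjInd]
  simp [excess, Finset.sum_sub_distrib]

lemma eCnt_le_exNum {W : Type*} {F : SimpleGraph W} {m : ℕ} {G : SimpleGraph (Fin m)}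
    (hG : FFree F G) : eCnt G ≤ exNum m F := by
  refine le_csSup ?_ ⟨G, hG, rfl⟩
  refine Set.Finite.bddAbove ?_
  refine (Set.finite_range (fun G : SimpleGraph (Fin m) => eCnt G)).subset ?_
  rintro _ ⟨G, _, rfl⟩
  exact ⟨G, rfl⟩

/-- A set meeting all parts equally spans few inner edges compared to missing cross edges. -/
lemma excess_le_of_balanced {W : Type*} {F : SimpleGraph W} {a N : ℕ} {G : SimpleGraph (Fin n)}
    (hr : 0 < r) (hG : FFree F G) (p : Fin n → Fin r)
    (hex : exNum (r * N) F = eCnt (turanGraph (r * N) r) + a)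
    (U : Finset (Fin n)) (hU : ∀ j, #{x ∈ U | p x = j} = N) : excess G p U ≤ 2 * a := by
  classical
  let e : ∀ j, Fin N ≃ {x // x ∈ U.filter (fun x => p x = j)} := fun j =>
    ((U.filter fun x => p x = j).equivFinOfCardEq (hU j)).symm
  let f : Fin (r * N) → Fin n := fun x =>
    (e ⟨x % r, Nat.mod_lt _ hr⟩ ⟨x / r, Nat.div_lt_of_lt_mul x.2⟩).1
  have hfU : ∀ x, f x ∈ U := fun x => (Finset.mem_filter.1 (e _ _).2).1
  have hfp : ∀ x, ((p (f x) : Fin r) : ℕ) = x % r := fun x => by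
    have := (Finset.mem_filter.1 (e ⟨x % r, Nat.mod_lt _ hr⟩
      ⟨x / r, Nat.div_lt_of_lt_mul x.2⟩).2).2
    exact congrArg Fin.val this
  have hinj : Function.Injective f := by
    intro x y hxy
    have hmod : (x : ℕ) % r = y % r := by rw [← hfp, ← hfp, hxy]
    have he : ∀ i j k l, i = j → (e i k).1 = (e j l).1 → k = l := by
      rintro i _ k l rfl hkl
      exact (e i).injective (Subtype.ext hkl)
    have hdiv : (x : ℕ) / r = y / r := congrArg Fin.val (he _ _ _ _ (Fin.ext hmod) hxy)
    apply Fin.ext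
    rw [← Nat.div_add_mod (x : ℕ) r, ← Nat.div_add_mod (y : ℕ) r, hmod, hdiv]
  have himg : univ.map ⟨f, hinj⟩ = U := by
    refine Finset.eq_of_subset_of_card_le ?_ ?_
    · intro x hx
      obtain ⟨y, _, rfl⟩ := Finset.mem_map.1 hx
      exact hfU y
    · rw [Finset.card_eq_sum_card_fiberwise (f := p) (t := univ) (fun _ _ => by simp)]
      simp [hU]
  have hfree : FFree F (G.comap f) := by
    rintro ⟨g, hg⟩
    exact hG ⟨⟨fun x => f (g x), fun h => g.map_rel h⟩, hinj.comp hg⟩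
  have hle := eCnt_le_exNum hfree
  rw [hex] at hle
  have hle' : (eCnt (G.comap f) : ℝ) ≤ eCnt (turanGraph (r * N) r) + a := by exact_mod_cast hle
  have h1 := sum_sum_adjInd (G.comap f)
  have h2 := sum_sum_adjInd (turanGraph (r * N) r)
  have h3 : excess G p U =
      ∑ x, ∑ y, adjInd (G.comap f) x y - ∑ x, ∑ y, adjInd (turanGraph (r * N) r) x y := by
    rw [excess, ← himg]
    simp only [Finset.sum_map, Function.Embedding.coeFn_mk, ← Finset.sum_sub_distrib]
    refine Finset.sum_congr rfl fun x _ => Finset.sum_congr rfl fun y _ => ?_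
    have hp : p (f x) = p (f y) ↔ (x : ℕ) % r = y % r := by
      rw [Fin.ext_iff, hfp, hfp]
    by_cases hadj : G.Adj (f x) (f y) <;> by_cases hxy : (x : ℕ) % r = y % r <;>
      simp [adjInd, inGraph, outGraph, turanGraph, hadj, hp, hxy]
  linarith

/-- Greedy extension of `S` to a set meeting every part in `N` vertices and spanning no edge
of `H`, with the new vertices taken from the prescribed sets `B j`. -/
lemma exists_balanced_independent {N D : ℕ} (H : SimpleGraph (Fin n)) (p : Fin n → Fin r)
    (S : Finset (Fin n)) (B : Fin r → Finset (Fin n))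
    (hSN : ∀ j, #{x ∈ S | p x = j} ≤ N)
    (hS : ∀ x ∈ S, ∀ y ∈ S, ¬ H.Adj x y)
    (hSB : ∀ x ∈ S, ∀ j, ∀ y ∈ B j, ¬ H.Adj x y)
    (hB : ∀ j, ∀ x ∈ B j, p x = j)
    (hD : ∀ j, ∀ x ∈ B j, ∑ y, adjInd H x y ≤ D)
    (hcard : ∀ j, r * N + r * N * D < #(B j)) :
    ∃ U, S ⊆ U ∧ (∀ x ∈ U, x ∈ S ∨ x ∈ B (p x)) ∧ (∀ j, #{x ∈ U | p x = j} = N) ∧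
      ∀ x ∈ U, ∀ y ∈ U, ¬ H.Adj x y := by
  classical
  let P : Finset (Finset (Fin n)) := univ.filter fun U => S ⊆ U ∧
    (∀ x ∈ U, x ∈ S ∨ x ∈ B (p x)) ∧ (∀ j, #{x ∈ U | p x = j} ≤ N) ∧
      ∀ x ∈ U, ∀ y ∈ U, ¬ H.Adj x y
  have hP : P.Nonempty :=
    ⟨S, Finset.mem_filter.2 ⟨mem_univ _, subset_rfl, fun x hx => .inl hx, hSN, hS⟩⟩
  obtain ⟨U, hUP, hmax⟩ := P.exists_max_image Finset.card hP
  obtain ⟨-, hSU, hUB, hUN, hUH⟩ := Finset.mem_filter.1 hUP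
  refine ⟨U, hSU, hUB, fun j => ?_, hUH⟩
  by_contra hne
  have hlt : #{x ∈ U | p x = j} < N := lt_of_le_of_ne (hUN j) hne
  have hUcard : #U ≤ r * N := by
    rw [Finset.card_eq_sum_card_fiberwise (f := p) (t := univ) (fun _ _ => by simp)]
    calc _ ≤ ∑ _j : Fin r, N := Finset.sum_le_sum fun j _ => hUN j
      _ = r * N := by simp
  let Z := U ∪ (U \ S).biUnion fun x => univ.filter fun y => H.Adj x y
  have hZ : #Z < #(B j) := by
    refine lt_of_le_of_lt ?_ (hcard j)
    refine (Finset.card_union_le _ _).trans (Nat.add_le_add hUcard ?_)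
    refine (Finset.card_biUnion_le_card_mul _ _ D fun x hx => ?_).trans
      (Nat.mul_le_mul_right _ ((Finset.card_le_card Finset.sdiff_subset).trans hUcard))
    obtain ⟨hxU, hxS⟩ := Finset.mem_sdiff.1 hx
    have := hD _ x ((hUB x hxU).resolve_left hxS)
    rw [sum_adjInd_eq_card] at this
    exact_mod_cast this
  obtain ⟨v, hvB, hvZ⟩ := Finset.exists_mem_notMem_of_card_lt_card hZ
  have hvU : v ∉ U := fun h => hvZ (Finset.mem_union_left _ h)
  have hpv : p v = j := hB j v hvB
  have hvH : ∀ x ∈ U, ¬ H.Adj x v := by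
    intro x hx hxv
    by_cases hxS : x ∈ S
    · exact hSB x hxS j v hvB hxv
    · exact hvZ (Finset.mem_union_right _ (Finset.mem_biUnion.2
        ⟨x, Finset.mem_sdiff.2 ⟨hx, hxS⟩, by simpa using hxv⟩))
  have hins : insert v U ∈ P := by
    refine Finset.mem_filter.2 ⟨mem_univ _, hSU.trans (Finset.subset_insert _ _), ?_, ?_, ?_⟩
    · intro x hx
      rcases Finset.mem_insert.1 hx with rfl | hx
      · right; rwa [hpv]
      · exact hUB x hx
    · intro i
      rw [Finset.filter_insert]
      split_ifs with hi
      · refine (Finset.card_insert_le _ _).trans ?_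
        have hij : i = j := hi.symm.trans hpv
        subst hij
        omega
      · exact hUN i
    · intro x hx y hy hxy
      rcases Finset.mem_insert.1 hx with hxv | hxU <;>
        rcases Finset.mem_insert.1 hy with hyv | hyU
      · exact H.ne_of_adj hxy (hxv.trans hyv.symm)
      · exact hvH y hyU (hxv ▸ hxy.symm)
      · exact hvH x hxU (hyv ▸ hxy)
      · exact hUH x hxU y hyU hxy
  have := hmax _ hins
  rw [Finset.card_insert_of_notMem hvU] at this
  omega

open scoped Classical in
lemma card_filter_lt_mul_le (H : SimpleGraph (Fin n)) (c : ℝ) :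
    #{x | c < ∑ y, adjInd H x y} * c ≤ ∑ x, ∑ y, adjInd H x y := by
  rw [← nsmul_eq_mul, ← Finset.sum_const]
  refine (Finset.sum_le_sum fun x hx => (Finset.mem_filter.1 hx).2.le).trans ?_
  exact Finset.sum_le_sum_of_subset_of_nonneg (Finset.filter_subset _ _)
    fun x _ _ => Finset.sum_nonneg fun y _ => adjInd_nonneg H x y

/-- In a graph with few edges, `S` extends greedily to a balanced independent set inside
prescribed sets of linear size. -/
lemma exists_balanced_independent_of_sparse {N : ℕ} {θ : ℝ} (hθ : 0 < θ) (hn : 0 < n)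
    (H : SimpleGraph (Fin n)) (p : Fin n → Fin r)
    (hsum : ∑ x, ∑ y, adjInd H x y ≤ θ ^ 3 * n ^ 2)
    (hlarge : (r * N : ℝ) + r * N * (θ ^ 2 * n) < θ * n)
    (S : Finset (Fin n)) (A : Fin r → Finset (Fin n))
    (hSN : ∀ j, #{x ∈ S | p x = j} ≤ N)
    (hS : ∀ x ∈ S, ∀ y ∈ S, ¬ H.Adj x y)
    (hSA : ∀ x ∈ S, ∀ j, ∀ y ∈ A j, ¬ H.Adj x y)
    (hA : ∀ j, ∀ x ∈ A j, p x = j)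
    (hcard : ∀ j, 2 * θ * n ≤ #(A j)) :
    ∃ U, S ⊆ U ∧ (∀ x ∈ U, x ∈ S ∨ x ∈ A (p x)) ∧ (∀ j, #{x ∈ U | p x = j} = N) ∧
      ∀ x ∈ U, ∀ y ∈ U, ¬ H.Adj x y := by
  classical
  have hn' : (0 : ℝ) < n := by exact_mod_cast hn
  let L : Finset (Fin n) := {x | θ ^ 2 * n < ∑ y, adjInd H x y}
  have hL : (#L : ℝ) ≤ θ * n := by
    have h1 := (card_filter_lt_mul_le H (θ ^ 2 * n)).trans hsum
    have h2 : (#L : ℝ) * (θ ^ 2 * n) ≤ (θ * n) * (θ ^ 2 * n) := by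
      refine h1.trans (le_of_eq ?_); ring
    exact le_of_mul_le_mul_right h2 (by positivity)
  obtain ⟨U, hSU, hUB, hUN, hUH⟩ := exists_balanced_independent (D := ⌊θ ^ 2 * n⌋₊) (N := N) H p S
    (fun j => A j \ L) hSN hS (fun x hx j y hy => hSA x hx j y (Finset.mem_sdiff.1 hy).1)
    (fun j x hx => hA j x (Finset.mem_sdiff.1 hx).1)
    (by
      intro j x hx
      have hxL : ∑ y, adjInd H x y ≤ θ ^ 2 * n := by
        by_contra! hlt
        exact (Finset.mem_sdiff.1 hx).2 (Finset.mem_filter.2 ⟨mem_univ _, hlt⟩)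
      rw [sum_adjInd_eq_card] at hxL ⊢
      exact_mod_cast Nat.le_floor hxL)
    (by
      intro j
      have h1 : (#(A j) : ℝ) ≤ #(A j \ L) + #L := by
        exact_mod_cast (Nat.sub_le_iff_le_add.1 (Finset.le_card_sdiff L (A j)))
      have h2 := hcard j
      have h3 : (⌊θ ^ 2 * n⌋₊ : ℝ) ≤ θ ^ 2 * n := Nat.floor_le (by positivity)
      have h4 : (r * N : ℝ) * ⌊θ ^ 2 * n⌋₊ ≤ r * N * (θ ^ 2 * n) := by gcongr
      have h5 : (r * N : ℝ) + r * N * ⌊θ ^ 2 * n⌋₊ < #(A j \ L) := by linarith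
      exact_mod_cast h5)
  exact ⟨U, hSU, fun x hx => (hUB x hx).imp_right fun h => (Finset.mem_sdiff.1 h).1, hUN, hUH⟩

lemma sum_sum_eq_of_symm (f : Fin n → Fin n → ℝ) (hf : ∀ x y, f x y = f y x) (v : Fin n)
    (hv : f v v = 0) :
    ∑ x, ∑ y, f x y = 2 * ∑ y, f v y + ∑ x ∈ univ.erase v, ∑ y ∈ univ.erase v, f x y := by
  have h1 : ∀ x, ∑ y, f x y = f v x + ∑ y ∈ univ.erase v, f x y := fun x => by
    rw [← Finset.add_sum_erase _ _ (mem_univ v), hf x v]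
  have h2 := Finset.add_sum_erase univ (fun x => ∑ y, f x y) (mem_univ v)
  have h3 := Finset.add_sum_erase univ (f v) (mem_univ v)
  rw [← h2]
  simp only [h1, Finset.sum_add_distrib]
  linarith

lemma two_mul_crossCnt (G : SimpleGraph (Fin n)) (q : Fin n → Fin r) :
    2 * (crossCnt G q : ℝ) =
      ∑ x, ∑ y, (adjInd G x y - adjInd (inGraph G q) x y) := by
  let H : SimpleGraph (Fin n) :=
    { Adj := fun x y => G.Adj x y ∧ q x ≠ q y
      symm := ⟨fun _ _ h => ⟨h.1.symm, h.2.symm⟩⟩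
      loopless := ⟨fun _ h => h.2 rfl⟩ }
  have hH : eCnt H = crossCnt G q := by
    have : H.edgeSet = {e | e ∈ G.edgeSet ∧ ¬ (Sym2.map q e).IsDiag} := by
      ext e
      induction e using Sym2.ind with
      | _ x y => simp [H]
    rw [eCnt, this]
    rfl
  rw [← hH, ← sum_sum_adjInd]
  refine Finset.sum_congr rfl fun x _ => Finset.sum_congr rfl fun y _ => ?_
  by_cases h1 : G.Adj x y <;> by_cases h2 : q x = q y <;> simp [adjInd, H, inGraph, h1, h2]

open scoped Classical in
/-- In a maximum cut, a vertex has no more neighbours in its own part than in any other part. -/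
lemma inDegree_le_of_maxCut (G : SimpleGraph (Fin n)) (p : Fin n → Fin r)
    (hmax : ∀ q : Fin n → Fin r, crossCnt G q ≤ crossCnt G p) (v : Fin n) (j : Fin r) :
    ∑ y, adjInd (inGraph G p) v y ≤ #{y | p y = j ∧ G.Adj v y} := by
  let q := Function.update p v j
  have hqp : 2 * (crossCnt G q : ℝ) ≤ 2 * (crossCnt G p : ℝ) := by
    exact_mod_cast Nat.mul_le_mul_left 2 (hmax q)
  have hsymm : ∀ (q : Fin n → Fin r) (x y : Fin n),
      adjInd G x y - adjInd (inGraph G q) x y = adjInd G y x - adjInd (inGraph G q) y x :=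
    fun q x y => by rw [adjInd_comm G, adjInd_comm (inGraph G q)]
  have hdiag : ∀ q : Fin n → Fin r, adjInd G v v - adjInd (inGraph G q) v v = 0 := fun q => by
    simp [adjInd]
  have herase : ∑ x ∈ univ.erase v, ∑ y ∈ univ.erase v,
        (adjInd G x y - adjInd (inGraph G q) x y) =
      ∑ x ∈ univ.erase v, ∑ y ∈ univ.erase v, (adjInd G x y - adjInd (inGraph G p) x y) := by
    refine Finset.sum_congr rfl fun x hx => Finset.sum_congr rfl fun y hy => ?_
    have hx' : q x = p x := Function.update_of_ne (Finset.ne_of_mem_erase hx) _ _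
    have hy' : q y = p y := Function.update_of_ne (Finset.ne_of_mem_erase hy) _ _
    have hiff : (inGraph G q).Adj x y ↔ (inGraph G p).Adj x y := by simp [inGraph, hx', hy']
    exact congrArg (adjInd G x y - ·) (if_congr hiff rfl rfl)
  rw [two_mul_crossCnt, two_mul_crossCnt, sum_sum_eq_of_symm _ (hsymm q) v (hdiag q),
    sum_sum_eq_of_symm _ (hsymm p) v (hdiag p), herase, Finset.sum_sub_distrib,
    Finset.sum_sub_distrib] at hqp
  have hq : ∑ y, adjInd (inGraph G q) v y ≤ #{y | p y = j ∧ G.Adj v y} := by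
    rw [sum_adjInd_eq_card]
    refine Nat.cast_le.2 (Finset.card_le_card fun y hy => ?_)
    obtain ⟨hadj, hy⟩ := (Finset.mem_filter.1 hy).2
    have hne : y ≠ v := (G.ne_of_adj hadj).symm
    simp only [q, Function.update_self, Function.update_of_ne hne] at hy
    simp [hy, hadj]
  linarith

/-- Deleting vertices missing many cross edges does not decrease the excess. -/
lemma excess_univ_le_excess (G : SimpleGraph (Fin n)) (p : Fin n → Fin r) (R : Finset (Fin n))
    (c : ℝ) (hin : ∀ v, ∑ y, adjInd (inGraph G p) v y ≤ c)
    (hout : ∀ v ∉ R, 2 * c ≤ ∑ y, adjInd (outGraph G p) v y) :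
    excess G p univ ≤ excess G p R := by
  classical
  set w : Fin n → Fin n → ℝ := fun x y =>
    adjInd (inGraph G p) x y - adjInd (outGraph G p) x y with hw
  have hwsymm : ∀ x y, w x y = w y x := fun x y => by
    simp only [hw, adjInd_comm _ x y]
  have h1 : excess G p univ = excess G p R + ∑ x ∈ Rᶜ, (∑ y, w x y + ∑ y ∈ R, w x y) := by
    have h2 : ∀ x, ∑ y, w x y = ∑ y ∈ R, w x y + ∑ y ∈ Rᶜ, w x y := fun x =>
      (Finset.sum_add_sum_compl R _).symm
    have h3 : ∑ x ∈ R, ∑ y ∈ Rᶜ, w x y = ∑ x ∈ Rᶜ, ∑ y ∈ R, w x y := by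
      rw [Finset.sum_comm]
      exact Finset.sum_congr rfl fun x _ => Finset.sum_congr rfl fun y _ => hwsymm _ _
    change ∑ x, ∑ y, w x y = ∑ x ∈ R, ∑ y ∈ R, w x y + _
    rw [← Finset.sum_add_sum_compl R, Finset.sum_add_distrib, ← h3]
    rw [Finset.sum_congr rfl fun x (_ : x ∈ R) => h2 x, Finset.sum_add_distrib]
    ring
  have h2 : ∑ x ∈ Rᶜ, (∑ y, w x y + ∑ y ∈ R, w x y) ≤ 0 := by
    refine Finset.sum_nonpos fun x hx => ?_
    have h3 := hout x (Finset.mem_compl.1 hx)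
    have h4 := hin x
    have h5 : ∑ y ∈ R, w x y ≤ ∑ y, adjInd (inGraph G p) x y := by
      refine (Finset.sum_le_sum fun y _ => ?_).trans
        (Finset.sum_le_sum_of_subset_of_nonneg (Finset.subset_univ R)
          fun y _ _ => adjInd_nonneg (inGraph G p) x y)
      exact sub_le_self _ (adjInd_nonneg _ _ _)
    have h6 : ∑ y, w x y =
        ∑ y, adjInd (inGraph G p) x y - ∑ y, adjInd (outGraph G p) x y :=
      Finset.sum_sub_distrib _ _
    linarith
  linarith

lemma excess_of_independent (G : SimpleGraph (Fin n)) (p : Fin n → Fin r) (U : Finset (Fin n))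
    (hU : ∀ x ∈ U, ∀ y ∈ U, ¬ (outGraph G p).Adj x y) :
    excess G p U = ∑ x ∈ U, ∑ y ∈ U, adjInd (inGraph G p) x y :=
  Finset.sum_congr rfl fun x hx => Finset.sum_congr rfl fun y hy => by
    rw [adjInd_of_not_adj (hU x hx y hy), sub_zero]

/-- Restricting to a subset containing all endpoints of inner edges does not decrease the
excess. -/
lemma excess_le_excess_of_subset (G : SimpleGraph (Fin n)) (p : Fin n → Fin r)
    {U R : Finset (Fin n)} (hUR : U ⊆ R)
    (hU : ∀ x ∈ R, ∀ y ∈ R, (inGraph G p).Adj x y → x ∈ U) :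
    excess G p R ≤ excess G p U := by
  have hle : ∀ x ∈ R, ∀ y ∈ R, x ∉ U ∨ y ∉ U →
      adjInd (inGraph G p) x y - adjInd (outGraph G p) x y ≤ 0 := by
    intro x hx y hy hxy
    rw [adjInd_of_not_adj (H := inGraph G p)]
    · linarith [adjInd_nonneg (outGraph G p) x y]
    · intro hadj
      rcases hxy with h | h
      · exact h (hU x hx y hy hadj)
      · exact h (hU y hy x hx hadj.symm)
  unfold excess
  rw [← Finset.sum_sdiff hUR]
  have h1 : ∑ x ∈ R \ U, ∑ y ∈ R,
      (adjInd (inGraph G p) x y - adjInd (outGraph G p) x y) ≤ 0 :=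
    Finset.sum_nonpos fun x hx => Finset.sum_nonpos fun y hy =>
      hle x (Finset.mem_sdiff.1 hx).1 y hy (.inl (Finset.mem_sdiff.1 hx).2)
  have h2 : ∑ x ∈ U, ∑ y ∈ R, (adjInd (inGraph G p) x y - adjInd (outGraph G p) x y) ≤
      ∑ x ∈ U, ∑ y ∈ U, (adjInd (inGraph G p) x y - adjInd (outGraph G p) x y) := by
    refine Finset.sum_le_sum fun x hx => ?_
    rw [← Finset.sum_sdiff hUR]
    have := Finset.sum_nonpos fun y (hy : y ∈ R \ U) =>
      hle x (hUR hx) y (Finset.mem_sdiff.1 hy).1 (.inr (Finset.mem_sdiff.1 hy).2)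
    linarith
  linarith

lemma inDegree_lt {N a : ℕ} {θ : ℝ} (hθ : 0 < θ) (hn : 0 < n) (hN : 2 * a + 2 ≤ N)
    (G : SimpleGraph (Fin n)) (p : Fin n → Fin r)
    (hmax : ∀ q : Fin n → Fin r, crossCnt G q ≤ crossCnt G p)
    (hbal : ∀ U : Finset (Fin n), (∀ j, #{x ∈ U | p x = j} = N) → excess G p U ≤ 2 * a)
    (hsum : ∑ x, ∑ y, adjInd (outGraph G p) x y ≤ θ ^ 3 * n ^ 2)
    (hlarge : (r * N : ℝ) + r * N * (θ ^ 2 * n) < θ * n) (v : Fin n) :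
    ∑ y, adjInd (inGraph G p) v y < 2 * θ * n := by
  classical
  by_contra! hv
  obtain ⟨U, hSU, hUA, hUN, hUH⟩ := exists_balanced_independent_of_sparse (N := N) hθ hn
    (outGraph G p) p hsum hlarge {v} (fun j => {y | p y = j ∧ G.Adj v y})
    (fun j => (Finset.card_filter_le _ _).trans (by simp; omega))
    (by simp)
    (by
      intro x hx j y hy hxy
      rw [Finset.mem_singleton.1 hx] at hxy
      exact hxy.2 (Finset.mem_filter.1 hy).2.2)
    (fun j x hx => (Finset.mem_filter.1 hx).2.1)
    (fun j => hv.trans (inDegree_le_of_maxCut G p hmax v j))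
  have hle := hbal U hUN
  rw [excess_of_independent G p U hUH] at hle
  have hvU : v ∈ U := hSU (Finset.mem_singleton_self v)
  have h1 : ∑ y ∈ U, adjInd (inGraph G p) v y ≤
      ∑ x ∈ U, ∑ y ∈ U, adjInd (inGraph G p) x y :=
    Finset.single_le_sum (f := fun x => ∑ y ∈ U, adjInd (inGraph G p) x y)
      (fun x _ => Finset.sum_nonneg fun y _ => adjInd_nonneg _ _ _) hvU
  rw [sum_adjInd_eq_card] at h1
  have h2 : (U.filter fun x => p x = p v) ⊆
      insert v (U.filter fun y => (inGraph G p).Adj v y) := by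
    intro y hy
    obtain ⟨hyU, hyp⟩ := Finset.mem_filter.1 hy
    rcases hUA y hyU with h | h
    · exact Finset.mem_insert.2 (.inl (Finset.mem_singleton.1 h))
    · exact Finset.mem_insert_of_mem (Finset.mem_filter.2
        ⟨hyU, (Finset.mem_filter.1 h).2.2, hyp.symm⟩)
  have h3 := (Finset.card_le_card h2).trans (Finset.card_insert_le _ _)
  rw [hUN] at h3
  have h4 : (2 * a + 1 : ℝ) ≤ #{y ∈ U | (inGraph G p).Adj v y} := by
    exact_mod_cast (by omega : 2 * a + 1 ≤ #{y ∈ U | (inGraph G p).Adj v y})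
  linarith

open scoped Classical in
lemma sum_sum_adjInd_eq_card (H : SimpleGraph (Fin n)) (S : Finset (Fin n)) :
    ∑ x ∈ S, ∑ y ∈ S, adjInd H x y = #{e ∈ S ×ˢ S | H.Adj e.1 e.2} := by
  rw [← Finset.sum_product']
  simp [adjInd, Finset.sum_boole]

/-- A part restricted to vertices missing few cross edges spans a bounded number of edges. -/
lemma sum_adjInd_part_le {N a : ℕ} {θ : ℝ} (hθ : 0 < θ) (hn : 0 < n) (hN : 4 * a + 2 ≤ N)
    (G : SimpleGraph (Fin n)) (p : Fin n → Fin r)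
    (hbal : ∀ U : Finset (Fin n), (∀ j, #{x ∈ U | p x = j} = N) → excess G p U ≤ 2 * a)
    (hsum : ∑ x, ∑ y, adjInd (outGraph G p) x y ≤ θ ^ 3 * n ^ 2)
    (hlarge : (r * N : ℝ) + r * N * (θ ^ 2 * n) < θ * n)
    (hpart : ∀ j, 2 * θ * n + N * (4 * θ * n) ≤ #{x | p x = j})
    (i : Fin r) (T : Finset (Fin n)) (hTi : ∀ x ∈ T, p x = i)
    (hT : ∀ x ∈ T, ∑ y, adjInd (outGraph G p) x y ≤ 4 * θ * n) :
    ∑ x ∈ T, ∑ y ∈ T, adjInd (inGraph G p) x y ≤ 2 * a := by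
  classical
  by_contra! hlt
  rw [sum_sum_adjInd_eq_card] at hlt
  obtain ⟨Q, hQ, hQcard⟩ := Finset.exists_subset_card_eq
    (Nat.succ_le_of_lt (by exact_mod_cast hlt :
      2 * a < #{e ∈ T ×ˢ T | (inGraph G p).Adj e.1 e.2}))
  have hQmem : ∀ e ∈ Q, (e.1 ∈ T ∧ e.2 ∈ T) ∧ (inGraph G p).Adj e.1 e.2 := fun e he => by
    simpa using hQ he
  let S := Q.image Prod.fst ∪ Q.image Prod.snd
  have hST : S ⊆ T := by
    intro x hx
    rcases Finset.mem_union.1 hx with h | h <;> obtain ⟨e, he, rfl⟩ := Finset.mem_image.1 h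
    · exact (hQmem e he).1.1
    · exact (hQmem e he).1.2
  have hScard : #S ≤ N := by
    have h1 := Finset.card_union_le (Q.image Prod.fst) (Q.image Prod.snd)
    have h2 : #(Q.image Prod.fst) ≤ #Q := Finset.card_image_le
    have h3 : #(Q.image Prod.snd) ≤ #Q := Finset.card_image_le
    have h4 : #S ≤ #(Q.image Prod.fst) + #(Q.image Prod.snd) := h1
    omega
  let Z := S.biUnion fun x => univ.filter fun y => (outGraph G p).Adj x y
  have hZ : (#Z : ℝ) ≤ N * (4 * θ * n) := by
    have h1 : (#Z : ℝ) ≤ ∑ x ∈ S, (#{y | (outGraph G p).Adj x y} : ℝ) := by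
      exact_mod_cast Finset.card_biUnion_le
    have h2 : ∑ x ∈ S, (#{y | (outGraph G p).Adj x y} : ℝ) ≤ ∑ _x ∈ S, 4 * θ * n :=
      Finset.sum_le_sum fun x hx => by
        rw [← sum_adjInd_eq_card]; exact hT x (hST hx)
    rw [Finset.sum_const, nsmul_eq_mul] at h2
    refine (h1.trans h2).trans ?_
    gcongr
  obtain ⟨U, hSU, -, hUN, hUH⟩ := exists_balanced_independent_of_sparse (N := N) hθ hn
    (outGraph G p) p hsum hlarge S (fun j => univ.filter (fun y => p y = j) \ Z)
    (fun j => (Finset.card_filter_le _ _).trans hScard)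
    (fun x hx y hy hxy => hxy.1 ((hTi x (hST hx)).trans (hTi y (hST hy)).symm))
    (fun x hx j y hy hxy => (Finset.mem_sdiff.1 hy).2
      (Finset.mem_biUnion.2 ⟨x, hx, by simpa using hxy⟩))
    (fun j x hx => (Finset.mem_filter.1 (Finset.mem_sdiff.1 hx).1).2)
    (fun j => by
      have h1 : (#{x | p x = j} : ℝ) ≤ #(univ.filter (fun y => p y = j) \ Z) + #Z := by
        exact_mod_cast Nat.sub_le_iff_le_add.1 (Finset.le_card_sdiff Z _)
      have h2 := hpart j
      linarith)
  have hle := hbal U hUN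
  rw [excess_of_independent G p U hUH, sum_sum_adjInd_eq_card] at hle
  have hQU : Q ⊆ (U ×ˢ U).filter fun e => (inGraph G p).Adj e.1 e.2 := by
    intro e he
    refine Finset.mem_filter.2 ⟨Finset.mem_product.2 ⟨hSU ?_, hSU ?_⟩, (hQmem e he).2⟩
    · exact Finset.mem_union_left _ (Finset.mem_image_of_mem _ he)
    · exact Finset.mem_union_right _ (Finset.mem_image_of_mem _ he)
  have h1 := Finset.card_le_card hQU
  have h2 : #{e ∈ U ×ˢ U | (inGraph G p).Adj e.1 e.2} ≤ 2 * a := by exact_mod_cast hle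
  omega

lemma excess_univ_le {N a : ℕ} {θ : ℝ} (hθ : 0 < θ) (hθ1 : θ ≤ 1) (hn : 0 < n) (hr : 0 < r)
    (hN : 4 * a + 2 ≤ N)
    (G : SimpleGraph (Fin n)) (p : Fin n → Fin r)
    (hmax : ∀ q : Fin n → Fin r, crossCnt G q ≤ crossCnt G p)
    (hbal : ∀ U : Finset (Fin n), (∀ j, #{x ∈ U | p x = j} = N) → excess G p U ≤ 2 * a)
    (hsum : ∑ x, ∑ y, adjInd (outGraph G p) x y ≤ θ ^ 3 * n ^ 2)
    (hlarge : (r * N : ℝ) + r * N * (θ ^ 2 * n) < θ * n)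
    (hpart : ∀ j, 2 * θ * n + N * (4 * θ * n) ≤ #{x | p x = j}) :
    excess G p univ ≤ 2 * a := by
  classical
  have hn' : (0 : ℝ) < n := by exact_mod_cast hn
  have hin := inDegree_lt hθ hn (by omega) G p hmax hbal hsum hlarge
  let L : Finset (Fin n) := {x | 4 * θ * n < ∑ y, adjInd (outGraph G p) x y}
  have hL : (#L : ℝ) ≤ θ * n := by
    have h1 := (card_filter_lt_mul_le (outGraph G p) (4 * θ * n)).trans hsum
    have h2 : (#L : ℝ) * (4 * θ * n) ≤ (θ ^ 2 / 4 * n) * (4 * θ * n) := by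
      refine h1.trans (le_of_eq ?_); ring
    have h3 := le_of_mul_le_mul_right h2 (by positivity)
    have h4 : θ ^ 2 / 4 ≤ θ := by nlinarith
    exact h3.trans (by gcongr)
  refine (excess_univ_le_excess G p Lᶜ (2 * θ * n) (fun v => (hin v).le) fun v hv => ?_).trans ?_
  · have hvL : v ∈ L := by simpa using hv
    have := (Finset.mem_filter.1 hvL).2
    linarith
  let R : Fin r → Finset (Fin n) := fun i => univ.filter (fun x => p x = i) \ L
  have hRp : ∀ i, ∀ x ∈ R i, p x = i := fun i x hx =>
    (Finset.mem_filter.1 (Finset.mem_sdiff.1 hx).1).2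
  have hmemR : ∀ x ∈ Lᶜ, x ∈ R (p x) := fun x hx =>
    Finset.mem_sdiff.2 ⟨by simp, Finset.mem_compl.1 hx⟩
  have hRcard : ∀ i, N ≤ #(R i) := by
    intro i
    have h1 : (#{x | p x = i} : ℝ) ≤ #(R i) + #L := by
      exact_mod_cast Nat.sub_le_iff_le_add.1 (Finset.le_card_sdiff L _)
    have h2 := hpart i
    have h3 : (N : ℝ) ≤ r * N := le_mul_of_one_le_left (by positivity) (by exact_mod_cast hr)
    have h4 : (0 : ℝ) ≤ r * N * (θ ^ 2 * n) := by positivity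
    have h5 : (0 : ℝ) ≤ N * (4 * θ * n) := by positivity
    have h6 : (N : ℝ) ≤ #(R i) := by linarith
    exact_mod_cast h6
  let S : Fin r → Finset (Fin n) := fun i =>
    (R i).filter fun x => ∃ y ∈ R i, (inGraph G p).Adj x y
  have hScard : ∀ i, #(S i) ≤ N := by
    intro i
    have h1 := sum_adjInd_part_le hθ hn hN G p hbal hsum hlarge hpart i (R i) (hRp i)
      (fun x hx => by
        by_contra! h
        exact (Finset.mem_sdiff.1 hx).2 (Finset.mem_filter.2 ⟨mem_univ _, h⟩))
    rw [sum_sum_adjInd_eq_card] at h1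
    have h2 : S i ⊆ ((R i ×ˢ R i).filter fun e => (inGraph G p).Adj e.1 e.2).image Prod.fst := by
      intro x hx
      obtain ⟨hxR, y, hyR, hxy⟩ := Finset.mem_filter.1 hx
      exact Finset.mem_image.2
        ⟨(x, y), Finset.mem_filter.2 ⟨Finset.mem_product.2 ⟨hxR, hyR⟩, hxy⟩, rfl⟩
    have h3 := (Finset.card_le_card h2).trans Finset.card_image_le
    have h4 : #{e ∈ R i ×ˢ R i | (inGraph G p).Adj e.1 e.2} ≤ 2 * a := by exact_mod_cast h1
    omega
  choose T hST hTR hTcard using fun i =>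
    Finset.exists_subsuperset_card_eq (Finset.filter_subset _ _ : S i ⊆ R i) (hScard i) (hRcard i)
  let U := univ.biUnion T
  have hU : ∀ j, #{x ∈ U | p x = j} = N := by
    intro j
    rw [← hTcard j]
    congr 1
    ext x
    simp only [U, Finset.mem_filter, Finset.mem_biUnion, mem_univ, true_and]
    constructor
    · rintro ⟨⟨i, hi⟩, rfl⟩
      rwa [hRp i x (hTR i hi)]
    · exact fun hx => ⟨⟨j, hx⟩, hRp j x (hTR j hx)⟩
  refine (excess_le_excess_of_subset G p (U := U) ?_ ?_).trans (hbal U hU)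
  · intro x hx
    obtain ⟨i, _, hi⟩ := Finset.mem_biUnion.1 hx
    exact Finset.mem_compl.2 (Finset.mem_sdiff.1 (hTR i hi)).2
  · intro x hx y hy hxy
    refine Finset.mem_biUnion.2
      ⟨p x, mem_univ _, hST _ (Finset.mem_filter.2 ⟨hmemR x hx, y, ?_, hxy⟩)⟩
    rw [hxy.2]
    exact hmemR y hy

end Helpers

theorem stmt_14 {W : Type*} (r a : ℕ) (hr : 2 ≤ r) (F : SimpleGraph W) (h : HypStar r a F) :
    ∃ ℓ₀ : ℕ, ∀ ℓ ≥ ℓ₀, ∀ θ ε : ℝ, 0 < θ → 0 < ε →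
      θ < 1 / (100 * r ^ 5 * ℓ) → 2 * ε < θ ^ 3 →
      ∃ n₀ : ℕ, ∀ n ≥ n₀, ∀ G : SimpleGraph (Fin n), SpecExtremal F G →
        ∀ p : Fin n → Fin r, GoodPartition r G ε p →
          (∑ i : Fin r, (inCnt G p i : ℤ)) -
            (Nat.card {e : Sym2 (Fin n) //
                ¬ (Sym2.map p e).IsDiag ∧ e ∉ G.edgeSet} : ℤ) ≤ a := by
  obtain ⟨m₀, hm₀⟩ := h
  set N := m₀ + 4 * a + 2 with hN
  refine ⟨N, fun ℓ hℓ θ ε hθ hε hθℓ hεθ => ?_⟩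
  have hNpos : 0 < N := by omega
  have hN1 : (1 : ℝ) ≤ N := by exact_mod_cast hNpos
  have hr2 : (2 : ℝ) ≤ r := by exact_mod_cast hr
  have hrN : (r * N : ℝ) * θ < 1 / 100 := by
    have h1 : (N : ℝ) ≤ ℓ := by exact_mod_cast hℓ
    have h2 : (r : ℝ) ≤ r ^ 5 := le_self_pow₀ (by linarith) (by norm_num)
    have h3 : (r * N : ℝ) ≤ r ^ 5 * ℓ := by gcongr
    have h4 : (0 : ℝ) < ℓ := by linarith
    rw [lt_div_iff₀ (by positivity)] at hθℓ
    nlinarith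
  have hθ1 : θ < 1 / 100 := by
    have h1 : (1 : ℝ) ≤ r * N := by nlinarith
    nlinarith
  have hsqrt : √ε < θ := by
    rw [Real.sqrt_lt' hθ]
    nlinarith [pow_pos hθ 2]
  obtain ⟨n₀, hn₀⟩ := exists_nat_gt (2 * (r * N : ℝ) / θ)
  refine ⟨n₀ + 1, fun n hn G hG p hp => ?_⟩
  obtain ⟨hmax, hin, hsize⟩ := hp
  have hnpos : 0 < n := by omega
  have hn' : (0 : ℝ) < n := by exact_mod_cast hnpos
  have hnlarge : 2 * (r * N : ℝ) < θ * n := by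
    have h1 : (n₀ : ℝ) ≤ n := by exact_mod_cast (by omega : n₀ ≤ n)
    rw [div_lt_iff₀ hθ] at hn₀
    nlinarith
  have hex := (hm₀ (r * N) (by nlinarith)).1
  by_contra! hlt
  rw [← eCnt_outGraph] at hlt
  have hlt' : (a : ℝ) < ∑ i, (inCnt G p i : ℝ) - (eCnt (outGraph G p) : ℝ) := by
    exact_mod_cast hlt
  have hexc := excess_univ G p
  have hle := excess_univ_le (N := N) (a := a) hθ (by linarith) hnpos (by omega) (by omega) G p hmax
    (fun U hU => excess_le_of_balanced (by omega) hG.1 p hex U hU) ?_ ?_ ?_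
  · linarith
  · rw [sum_sum_adjInd]
    have h1 : 2 * ε * (n : ℝ) ^ 2 ≤ θ ^ 3 * n ^ 2 := by gcongr
    have h2 : (0 : ℝ) ≤ a := by positivity
    linarith
  · have h1 : (r * N : ℝ) * (θ ^ 2 * n) = (r * N * θ) * (θ * n) := by ring
    have h2 : (r * N * θ : ℝ) * (θ * n) ≤ 1 / 100 * (θ * n) := by gcongr
    have h3 : 0 < θ * n := by positivity
    linarith
  · intro j
    have h1 := (hsize j).1
    have h2 : partSize p j = Finset.card {x | p x = j} := by
      rw [partSize, Nat.card_eq_fintype_card, Fintype.card_subtype]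
    rw [← h2]
    refine le_trans ?_ h1.le
    have h3 : 2 * θ + N * (4 * θ) ≤ 1 / (r : ℝ) - 3 * √ε := by
      have h4 : (9 * N * θ : ℝ) ≤ 1 / r := by
        rw [le_div_iff₀ (by linarith)]
        nlinarith
      nlinarith
    calc 2 * θ * n + N * (4 * θ * n) = (2 * θ + N * (4 * θ)) * n := by ring
      _ ≤ _ := by gcongr
end

section
/- Let r ≥ 2 be an integer and let 0 < ε < 1/(100 r²). There exist a constant c₁ > 0 and n₀ such that for every n ≥ n₀ and all positive integers n₁, …, n_r with n₁ + … + n_r = n, with (1/r − 3√ε)·n < n_i < (1/r + 3√ε)·n for each i ∈ [r], and with n_i − n_j ≥ 2 for some pair of indices i, j, one has λ(T_{n,r}) − λ(K_r(n₁, …, n_r)) ≥ c₁/n. -/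
open SimpleGraph

section Multipartite

variable {V ι : Type*} [Fintype V] [DecidableEq ι]

/-- A real number is in the spectrum of a matrix iff it has an eigenvector. -/
lemma mem_spectrum_iff_exists_mulVec_eq [DecidableEq V] (A : Matrix V V ℝ) (μ : ℝ) :
    μ ∈ spectrum ℝ A ↔ ∃ v : V → ℝ, v ≠ 0 ∧ A.mulVec v = μ • v := by
  rw [← Matrix.spectrum_toLin', ← Module.End.hasEigenvalue_iff_mem_spectrum]
  constructor
  · intro h
    obtain ⟨v, hv⟩ := h.exists_hasEigenvector
    exact ⟨v, hv.2, by simpa using hv.apply_eq_smul⟩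
  · rintro ⟨v, hv, h⟩
    exact Module.End.hasEigenvalue_of_hasEigenvector (x := v)
      ⟨Module.End.mem_eigenspace_iff.2 (by simpa using h), hv⟩

lemma adjMat_mulVec_of_adj_iff_ne {G : SimpleGraph V} {p : V → ι}
    (hG : ∀ u w, G.Adj u w ↔ p u ≠ p w) (v : V → ℝ) (u : V) :
    (adjMat G).mulVec v u = ∑ w, v w - ∑ w with p w = p u, v w := by
  classical
  rw [eq_sub_iff_add_eq, Finset.sum_filter, adjMat, Matrix.mulVec, dotProduct,
    ← Finset.sum_add_distrib]
  refine Finset.sum_congr rfl fun w _ => ?_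
  by_cases h : p w = p u
  · simp [SimpleGraph.adjMatrix_apply, hG, h]
  · simp [SimpleGraph.adjMatrix_apply, hG, h, Ne.symm h]

variable [Fintype ι]

lemma sum_comp_eq_sum_card_fiber {p : V → ι} {c : ι → ℕ}
    (hc : ∀ i, Finset.card {v | p v = i} = c i) (g : ι → ℝ) :
    ∑ v, g (p v) = ∑ i, c i * g i := by
  rw [← Finset.sum_fiberwise Finset.univ p]
  refine Finset.sum_congr rfl fun i _ => ?_
  rw [Finset.sum_congr rfl (g := fun _ => g i) fun v hv => by rw [(Finset.mem_filter.1 hv).2]]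
  simp [hc]

/-- A positive root of `∑ cᵢ / (x + cᵢ) = 1` is at most the spectral radius of the complete
multipartite graph with part sizes `cᵢ`. -/
lemma le_specRad_of_sum_eq_one [DecidableEq V] {G : SimpleGraph V} {p : V → ι} {c : ι → ℕ}
    (hG : ∀ u w, G.Adj u w ↔ p u ≠ p w) (hc : ∀ i, Finset.card {v | p v = i} = c i)
    {x : ℝ} (hx : 0 < x) (h : ∑ i, (c i : ℝ) / (x + c i) = 1) : x ≤ specRad G := by
  refine le_csSup (Matrix.finite_real_spectrum (𝕜 := ℝ)).bddAbove ?_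
  rw [mem_spectrum_iff_exists_mulVec_eq]
  have hpos : ∀ i, 0 < x + c i := fun i => by positivity
  refine ⟨fun v => (x + c (p v))⁻¹, fun h0 => ?_, ?_⟩
  · have hV : IsEmpty V := ⟨fun v => (inv_pos.2 (hpos (p v))).ne' (congrFun h0 v)⟩
    have : ∀ i, c i = 0 := fun i => by rw [← hc i]; simp
    simp [this] at h
  · funext u
    rw [adjMat_mulVec_of_adj_iff_ne hG, sum_comp_eq_sum_card_fiber hc fun i => (x + c i)⁻¹]
    have hfib : ∑ w with p w = p u, (x + c (p w))⁻¹ = c (p u) * (x + c (p u))⁻¹ := by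
      rw [Finset.sum_congr rfl (g := fun _ => (x + c (p u))⁻¹)
        fun w hw => by rw [(Finset.mem_filter.1 hw).2]]
      simp [hc]
    simp only [div_eq_mul_inv] at h
    rw [hfib, h, Pi.smul_apply, smul_eq_mul]
    have := (hpos (p u)).ne'
    field_simp
    ring

/-- The spectral radius of the complete multipartite graph with part sizes `cᵢ` is at most
every positive root of `∑ cᵢ / (x + cᵢ) = 1`. -/
lemma specRad_le_of_sum_eq_one [DecidableEq V] {G : SimpleGraph V} {p : V → ι} {c : ι → ℕ}
    (hG : ∀ u w, G.Adj u w ↔ p u ≠ p w) (hc : ∀ i, Finset.card {v | p v = i} = c i)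
    {x : ℝ} (hx : 0 < x) (h : ∑ i, (c i : ℝ) / (x + c i) = 1) : specRad G ≤ x := by
  refine Real.sSup_le (fun μ hμ => ?_) hx.le
  obtain ⟨v, hv, hAv⟩ := (mem_spectrum_iff_exists_mulVec_eq _ _).1 hμ
  by_contra! hlt
  have hμ0 : 0 < μ := hx.trans hlt
  have hpos : ∀ i, 0 < μ + c i := fun i => by positivity
  set S := ∑ w, v w with hS
  have heq : ∀ u, μ * v u = S - ∑ w with p w = p u, v w := fun u => by
    rw [← adjMat_mulVec_of_adj_iff_ne hG, hAv, Pi.smul_apply, smul_eq_mul]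
  have hconst : ∀ u w, p w = p u → v w = v u := fun u w huw =>
    mul_left_cancel₀ hμ0.ne' (by rw [heq u, heq w, huw])
  have hval : ∀ u, v u = S * (μ + c (p u))⁻¹ := fun u => by
    rw [← div_eq_mul_inv, eq_div_iff (hpos _).ne']
    have := heq u
    rw [Finset.sum_congr rfl (g := fun _ => v u)
      fun w hw => hconst u w (Finset.mem_filter.1 hw).2] at this
    simp [hc] at this
    linarith
  have hS0 : S ≠ 0 := fun h0 => hv (funext fun u => by simp [hval u, h0])
  have hSS : S = S * ∑ i, (c i : ℝ) / (μ + c i) := by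
    conv_lhs => rw [hS, Finset.sum_congr rfl fun w _ => hval w, ← Finset.mul_sum,
      sum_comp_eq_sum_card_fiber hc fun i => (μ + c i)⁻¹]
    simp only [div_eq_mul_inv]
  have hsum : ∑ i, (c i : ℝ) / (μ + c i) = 1 := by
    simpa [hS0] using hSS.symm
  obtain ⟨i, -, hi⟩ : ∃ i ∈ Finset.univ, (c i : ℝ) / (x + c i) ≠ 0 :=
    Finset.exists_ne_zero_of_sum_ne_zero (by rw [h]; exact one_ne_zero)
  have hci : (0 : ℝ) < c i := lt_of_le_of_ne (by positivity) fun h0 => hi (by simp [← h0])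
  refine absurd (hsum.trans h.symm) (ne_of_lt (Finset.sum_lt_sum (fun j _ => ?_) ⟨i, by simp, ?_⟩))
  · gcongr
  · gcongr

end Multipartite

/-- The gap between the chord of `m ↦ m / (x + m)` through `q` and `q + 1` and the function. -/
lemma chord_sub_div_add {x q m : ℝ} (hm : x + m ≠ 0) (hq : x + q ≠ 0) (hq' : x + q + 1 ≠ 0) :
    q / (x + q) + (m - q) * (x / ((x + q) * (x + q + 1))) - m / (x + m) =
      x * ((m - q) * (m - q - 1)) / ((x + m) * (x + q) * (x + q + 1)) := by
  field_simp
  ring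

/-- Balanced part sizes beat unbalanced ones for `∑ cᵢ / (x + cᵢ)`, quantitatively. -/
lemma sum_div_add_add_le {ι : Type*} [Fintype ι] {c t : ι → ℕ} {q n : ℕ} {x : ℝ}
    (hcn : ∑ i, c i = n) (htn : ∑ i, t i = n) (ht : ∀ i, t i = q ∨ t i = q + 1)
    (hq : q ≤ n) (hn : 0 < n) (hx : 0 < x) (hxn : x ≤ n) (hne : ∃ i j, c j + 2 ≤ c i) :
    ∑ i, (c i : ℝ) / (x + c i) + x / (6 * n ^ 3) ≤ ∑ i, (t i : ℝ) / (x + t i) := by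
  have hchord (a : ι → ℕ) (ha : ∑ i, a i = n) :
      ∑ i, (a i : ℝ) / (x + a i) = (∑ _i : ι, (q : ℝ) / (x + q) +
        (n - ∑ _i : ι, (q : ℝ)) * (x / ((x + q) * (x + q + 1)))) -
      ∑ i, x * ((a i - q : ℝ) * (a i - q - 1)) / ((x + a i) * (x + q) * (x + q + 1)) := by
    have hcast : ∑ i, (a i : ℝ) = n := by exact_mod_cast ha
    rw [← hcast, ← Finset.sum_sub_distrib, Finset.sum_mul, ← Finset.sum_add_distrib,
      ← Finset.sum_sub_distrib]
    refine Finset.sum_congr rfl fun i _ => ?_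
    rw [← chord_sub_div_add (by positivity) (by positivity) (by positivity)]
    ring
  have htz : ∑ i, x * ((t i - q : ℝ) * (t i - q - 1)) /
      ((x + t i) * (x + q) * (x + q + 1)) = 0 :=
    Finset.sum_eq_zero fun i _ => by rcases ht i with h | h <;> simp [h]
  have hprod (i : ι) : (0 : ℝ) ≤ (c i - q : ℝ) * (c i - q - 1) := by
    rcases le_or_gt (c i) q with h | h
    · have : (c i : ℝ) ≤ q := by exact_mod_cast h
      nlinarith
    · have : (q : ℝ) + 1 ≤ c i := by exact_mod_cast h
      nlinarith
  obtain ⟨k, hk⟩ : ∃ k, (2 : ℝ) ≤ (c k - q : ℝ) * (c k - q - 1) := by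
    obtain ⟨i, j, hij⟩ := hne
    rcases le_or_gt (q + 2) (c i) with h | h
    · have : (q : ℝ) + 2 ≤ c i := by exact_mod_cast h
      exact ⟨i, by nlinarith⟩
    · have : (c j : ℝ) + 1 ≤ q := by exact_mod_cast (by omega : c j + 1 ≤ q)
      exact ⟨j, by nlinarith⟩
  have hck : (c k : ℝ) ≤ n := by
    exact_mod_cast hcn ▸ Finset.single_le_sum (fun i _ => Nat.zero_le (c i)) (Finset.mem_univ k)
  have hqn : (q : ℝ) ≤ n := by exact_mod_cast hq
  have hn1 : (1 : ℝ) ≤ n := by exact_mod_cast hn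
  have hterm : x / (6 * n ^ 3) ≤
      x * ((c k - q : ℝ) * (c k - q - 1)) / ((x + c k) * (x + q) * (x + q + 1)) := by
    calc x / (6 * n ^ 3) = x * 2 / ((2 * n) * (2 * n) * (3 * n)) := by field_simp; norm_num
      _ ≤ _ := by
        gcongr
        · linarith
        · linarith
        · linarith
  have hsum := Finset.single_le_sum (f := fun i =>
    x * ((c i - q : ℝ) * (c i - q - 1)) / ((x + c i) * (x + q) * (x + q + 1)))
    (fun i _ => div_nonneg (mul_nonneg hx.le (hprod i)) (by positivity)) (Finset.mem_univ k)
  rw [hchord c hcn, hchord t htn, htz]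
  linarith

/-- If `∑ aᵢ / (x + aᵢ) ≥ 1` with `0 < x ≤ n = ∑ aᵢ`, the equation `∑ aᵢ / (y + aᵢ) = 1`
has a root in `[x, n]`. -/
lemma exists_sum_div_add_eq_one {ι : Type*} [Fintype ι] {a : ι → ℕ} {n : ℕ} {x : ℝ}
    (han : ∑ i, a i = n) (hx : 0 < x) (hxn : x ≤ n) (h : 1 ≤ ∑ i, (a i : ℝ) / (x + a i)) :
    ∃ y, x ≤ y ∧ y ≤ n ∧ ∑ i, (a i : ℝ) / (y + a i) = 1 := by
  have hn : (0 : ℝ) < n := hx.trans_le hxn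
  have hcont : ContinuousOn (fun y : ℝ => ∑ i, (a i : ℝ) / (y + a i)) (Set.Icc x n) := by
    refine continuousOn_finsetSum _ fun i _ => ContinuousOn.div (by fun_prop) (by fun_prop) ?_
    intro y hy
    have : 0 < y := hx.trans_le hy.1
    positivity
  have hle : ∑ i, (a i : ℝ) / (n + a i) ≤ 1 := by
    calc ∑ i, (a i : ℝ) / (n + a i) ≤ ∑ i, (a i : ℝ) / n := by
          gcongr with i
          simp
      _ = 1 := by
          rw [← Finset.sum_div, ← Nat.cast_sum, han, div_self hn.ne']
  obtain ⟨y, hy, hy1⟩ := intermediate_value_Icc' hxn hcont ⟨hle, h⟩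
  exact ⟨y, hy.1, hy.2, hy1⟩

lemma card_fin_mod_eq {r : ℕ} (hr : 0 < r) (n : ℕ) (i : Fin r) :
    Finset.card {v : Fin n | (⟨v % r, Nat.mod_lt _ hr⟩ : Fin r) = i} =
      n / r + if (i : ℕ) < n % r then 1 else 0 := by
  have h := Nat.count_modEq_card n hr i
  rw [Nat.mod_eq_of_lt i.2] at h
  rw [← h, Nat.count_eq_card_filter_range, ← Nat.Iio_eq_range, ← Fin.map_valEmbedding_univ,
    Finset.filter_map, Finset.card_map]
  congr 1
  ext v
  simp [Fin.ext_iff, Nat.ModEq, Nat.mod_eq_of_lt i.2]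

theorem stmt_16 (r : ℕ) (hr : 2 ≤ r) (ε : ℝ) (hε : 0 < ε) (hε' : ε < 1 / (100 * r ^ 2)) :
    ∃ c₁ : ℝ, 0 < c₁ ∧ ∃ n₀ : ℕ, ∀ n ≥ n₀, ∀ c : Fin r → ℕ,
      (∀ i, 0 < c i) → (∑ i, c i) = n →
      (∀ i, (1 / (r : ℝ) - 3 * Real.sqrt ε) * n < c i ∧
        (c i : ℝ) < (1 / (r : ℝ) + 3 * Real.sqrt ε) * n) →
      (∃ i j, c j + 2 ≤ c i) →
      c₁ / n ≤ specRad (turanGraph n r) -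
        specRad (completeMultipartiteGraph fun k => Fin (c k)) := by
  have hr0 : (0 : ℝ) < r := by positivity
  have hr2 : (2 : ℝ) ≤ r := by exact_mod_cast hr
  obtain ⟨κ, hκ⟩ : ∃ κ : ℝ, κ = 7 / (10 * r) := ⟨_, rfl⟩
  have hκ0 : 0 < κ := by rw [hκ]; positivity
  have hsqrt : Real.sqrt ε < 1 / (10 * r) := by
    rw [Real.sqrt_lt' (by positivity)]
    convert hε' using 1
    field_simp
    norm_num
  have hκle : κ ≤ 1 / (r : ℝ) - 3 * Real.sqrt ε := by
    have : κ = 1 / (r : ℝ) - 3 * (1 / (10 * r)) := by rw [hκ]; field_simp; norm_num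
    linarith
  have hκ1 : κ ≤ 1 := by
    rw [hκ, div_le_one (by positivity)]
    linarith
  refine ⟨κ ^ 3 / 6, by positivity, 0, fun n _ c hc hcn hbd hne => ?_⟩
  have hn : 0 < n := by
    rw [← hcn]
    exact (hc ⟨0, by omega⟩).trans_le
      (Finset.single_le_sum (fun i _ => Nat.zero_le (c i)) (Finset.mem_univ _))
  have hnR : (0 : ℝ) < n := by exact_mod_cast hn
  have hκc : ∀ i, κ * n ≤ c i := fun i => by
    have := (hbd i).1
    nlinarith
  -- the spectral radius of the complete multipartite graph
  obtain ⟨x, hκx, hxn, hx1⟩ : ∃ x, κ * n ≤ x ∧ x ≤ n ∧ ∑ i, (c i : ℝ) / (x + c i) = 1 := by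
    refine exists_sum_div_add_eq_one hcn (by positivity) (by nlinarith) ?_
    calc (1 : ℝ) ≤ ∑ _i : Fin r, (1 / 2 : ℝ) := by simp; linarith
      _ ≤ _ := by
        refine Finset.sum_le_sum fun i _ => ?_
        have := hκc i
        rw [div_le_div_iff₀ (by norm_num) (by positivity)]
        linarith
  have hx0 : 0 < x := lt_of_lt_of_le (by positivity) hκx
  have hK : specRad (completeMultipartiteGraph fun k => Fin (c k)) ≤ x := by
    refine specRad_le_of_sum_eq_one (p := Sigma.fst) (fun u w => by simp) (fun i => ?_) hx0 hx1
    rw [← Fintype.card_subtype, Fintype.card_congr (Equiv.sigmaSubtype i)]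
    simp
  -- the spectral radius of the Turán graph
  have hr' : 0 < r := by omega
  let t : Fin r → ℕ := fun i => n / r + if (i : ℕ) < n % r then 1 else 0
  have htcard := card_fin_mod_eq hr' n
  have htn : ∑ i, t i = n := by
    have := Finset.card_eq_sum_card_fiberwise (s := (Finset.univ : Finset (Fin n)))
      (t := Finset.univ) (f := fun v : Fin n => (⟨v % r, Nat.mod_lt _ hr'⟩ : Fin r)) (by simp)
    rw [Finset.card_univ, Fintype.card_fin] at this
    rw [this]
    exact Finset.sum_congr rfl fun i _ => (htcard i).symm
  have hgap := sum_div_add_add_le hcn htn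
    (fun i => by by_cases h : (i : ℕ) < n % r <;> simp [t, h])
    (Nat.div_le_self n r) hn hx0 hxn hne
  rw [hx1] at hgap
  have hgap0 : 0 < x / (6 * n ^ 3) := by positivity
  obtain ⟨y, hxy, -, hy1⟩ := exists_sum_div_add_eq_one htn hx0 hxn (by linarith)
  have hT : y ≤ specRad (turanGraph n r) :=
    le_specRad_of_sum_eq_one (p := fun v : Fin n => (⟨v % r, Nat.mod_lt _ hr'⟩ : Fin r))
      (fun u w => by simp [turanGraph_adj]) htcard (hx0.trans_le hxy) hy1
  have hdiff : ∑ i, (t i : ℝ) / (x + t i) - ∑ i, (t i : ℝ) / (y + t i) ≤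
      (y - x) / (κ ^ 2 * n) := by
    have hcast : ∑ i, (t i : ℝ) = n := by exact_mod_cast htn
    calc _ = ∑ i, (t i : ℝ) * ((y - x) / ((x + t i) * (y + t i))) := by
          rw [← Finset.sum_sub_distrib]
          refine Finset.sum_congr rfl fun i _ => ?_
          have : 0 < y := hx0.trans_le hxy
          field_simp
          ring
      _ ≤ ∑ i, (t i : ℝ) * ((y - x) / ((κ * n) * (κ * n))) := by
          have hyx : 0 ≤ y - x := by linarith
          gcongr with i
          · have : (0 : ℝ) ≤ t i := by positivity
            linarith
          · have : (0 : ℝ) ≤ t i := by positivity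
            linarith
      _ = _ := by
          rw [← Finset.sum_mul, hcast]
          field_simp
  have hfin : κ ^ 3 / 6 / n ≤ y - x := by
    have h1 : x / (6 * n ^ 3) ≤ (y - x) / (κ ^ 2 * n) := by linarith
    have h2 : κ * n / (6 * n ^ 3) ≤ x / (6 * n ^ 3) := by gcongr
    have h3 := h2.trans h1
    rw [le_div_iff₀ (by positivity)] at h3
    calc κ ^ 3 / 6 / n = κ * n / (6 * n ^ 3) * (κ ^ 2 * n) := by field_simp
      _ ≤ _ := h3
  linarith
end
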